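/- arXiv:2406.07866 — 3 statements merged into one kernel-verified Lean document; each statement's English description precedes it below -/
import Mathlib

section
/- Let Δ > 0, ρ > 0, 0 < ε < 1/2, and k ≥ log(1/ε − 1)/ρ. Then for all real numbers a, b with |a| ≤ Δ: |SR_k(a, b) − HR(a, b)| ≤ Δ·(1/2)·𝟙{|b| < ρ} + Δ·ε, where 𝟙{|b| < ρ} equals 1 if |b| < ρ and 0 otherwise. -/
open Real

/-- Soft regret with parameter `k` of `a` against `b`:
`SR_k(a, b) = |a| / (1 + exp (k · sgn a · b))`. -/
noncomputable def softRegret (k a b : ℝ) : ℝ :=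
  |a| / (1 + Real.exp (k * Real.sign a * b))

/-- Hard regret: `HR(a, b) = |a|` if `sgn a ≠ sgn b` and `0` otherwise. -/
noncomputable def hardRegret (a b : ℝ) : ℝ :=
  if Real.sign a ≠ Real.sign b then |a| else 0

/-- For `Δ > 0`, `ρ > 0`, `0 < ε < 1/2`, `k ≥ log (1/ε − 1)/ρ`, and all reals `a, b`
with `|a| ≤ Δ`:
`|SR_k(a, b) − HR(a, b)| ≤ Δ·(1/2)·𝟙{|b| < ρ} + Δ·ε`. -/
theorem soft_hard_regret_gap (Δ ρ ε k : ℝ) (hΔ : 0 < Δ) (hρ : 0 < ρ)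
    (hε0 : 0 < ε) (hε1 : ε < 1 / 2) (hk : k ≥ Real.log (1 / ε - 1) / ρ) :
    ∀ a b : ℝ, |a| ≤ Δ →
      |softRegret k a b - hardRegret a b| ≤
        Δ * (1 / 2) * (if |b| < ρ then (1 : ℝ) else 0) + Δ * ε := by
  intro a b hab
  have h1 : 1 < 1 / ε - 1 := by
    have : 2 < 1 / ε := by rw [lt_div_iff₀ hε0]; linarith
    linarith
  have hlog : 0 < Real.log (1 / ε - 1) := Real.log_pos h1
  have hk' : Real.log (1 / ε - 1) ≤ k * ρ := (div_le_iff₀ hρ).1 hk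
  have hk0 : 0 < k := lt_of_lt_of_le (div_pos hlog hρ) hk
  have core : 1 / (1 + Real.exp (k * |b|)) ≤
      (1 / 2) * (if |b| < ρ then (1 : ℝ) else 0) + ε := by
    split_ifs with h
    · have : 1 ≤ Real.exp (k * |b|) := Real.one_le_exp (by positivity)
      have : 1 / (1 + Real.exp (k * |b|)) ≤ 1 / 2 :=
        one_div_le_one_div_of_le (by norm_num) (by linarith)
      linarith
    · have h2 : k * ρ ≤ k * |b| := mul_le_mul_of_nonneg_left (not_lt.1 h) hk0.le
      have h3 : 1 / ε - 1 ≤ Real.exp (k * |b|) :=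
        (Real.log_le_iff_le_exp (by linarith)).1 (hk'.trans h2)
      have h4 : 1 / (1 + Real.exp (k * |b|)) ≤ 1 / (1 / ε) :=
        one_div_le_one_div_of_le (by positivity) (by linarith)
      rw [one_div_one_div] at h4
      linarith
  have flip : ∀ x : ℝ, |a| / (1 + Real.exp (-x)) - |a| = -(|a| * (1 / (1 + Real.exp x))) := by
    intro x
    rw [Real.exp_neg]
    have := Real.exp_pos x
    field_simp
    ring
  have key : |softRegret k a b - hardRegret a b| ≤ |a| * (1 / (1 + Real.exp (k * |b|))) := by
    have hp : 0 ≤ |a| * (1 / (1 + Real.exp (k * |b|))) := by positivity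
    have pos : |a| / (1 + Real.exp (k * |b|)) - 0 = |a| * (1 / (1 + Real.exp (k * |b|))) := by
      ring
    have neg := flip (k * |b|)
    unfold softRegret hardRegret
    rcases lt_trichotomy a 0 with ha | ha | ha
    · rcases lt_trichotomy b 0 with hb | hb | hb
      · rw [Real.sign_of_neg ha, Real.sign_of_neg hb, if_neg (by simp),
          show k * -1 * b = k * |b| by rw [abs_of_neg hb]; ring, pos, abs_of_nonneg hp]
      · rw [Real.sign_of_neg ha, if_pos (by rw [hb, Real.sign_zero]; norm_num),
          show k * -1 * b = -(k * |b|) by rw [hb]; simp, neg, abs_neg, abs_of_nonneg hp]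
      · rw [Real.sign_of_neg ha, Real.sign_of_pos hb, if_pos (by norm_num),
          show k * -1 * b = -(k * |b|) by rw [abs_of_pos hb]; ring, neg, abs_neg,
          abs_of_nonneg hp]
    · subst ha
      simp
    · rcases lt_trichotomy b 0 with hb | hb | hb
      · rw [Real.sign_of_pos ha, Real.sign_of_neg hb, if_pos (by norm_num),
          show k * 1 * b = -(k * |b|) by rw [abs_of_neg hb]; ring, neg, abs_neg,
          abs_of_nonneg hp]
      · rw [Real.sign_of_pos ha, if_pos (by rw [hb, Real.sign_zero]; norm_num),
          show k * 1 * b = -(k * |b|) by rw [hb]; simp, neg, abs_neg, abs_of_nonneg hp]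
      · rw [Real.sign_of_pos ha, Real.sign_of_pos hb, if_neg (by simp),
          show k * 1 * b = k * |b| by rw [abs_of_pos hb]; ring, pos, abs_of_nonneg hp]
  calc _ ≤ |a| * (1 / (1 + Real.exp (k * |b|))) := key
    _ ≤ Δ * (1 / (1 + Real.exp (k * |b|))) := mul_le_mul_of_nonneg_right hab (by positivity)
    _ ≤ Δ * ((1 / 2) * (if |b| < ρ then (1 : ℝ) else 0) + ε) :=
        mul_le_mul_of_nonneg_left core hΔ.le
    _ = _ := by ring
end

section
/- Let (𝒲, 𝔄) be a measurable space with probability measure μ, let Δ > 0, and let δ : 𝒲 → ℝ and g : 𝒲 → ℝ be measurable functions with |δ(w)| ≤ Δ for all w. Let ρ > 0, 0 < ε < 1/2, and k ≥ log(1/ε − 1)/ρ. Then |∫ SR_k(δ(w), g(w)) dμ(w) − ∫ HR(δ(w), g(w)) dμ(w)| ≤ Δ·( μ{w : |g(w)| < ρ}/2 + ε ). -/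
open MeasureTheory Real

lemma aux_sign_meas : Measurable Real.sign := by
  unfold Real.sign
  exact Measurable.ite measurableSet_Iio measurable_const
    (Measurable.ite measurableSet_Ioi measurable_const measurable_const)

lemma aux_sig (ρ ε k t : ℝ) (hρ : 0 < ρ) (hε0 : 0 < ε) (hε1 : ε < 1 / 2)
    (hk : k ≥ Real.log (1 / ε - 1) / ρ) (ht : 0 ≤ t) :
    1 / (1 + Real.exp (k * t)) ≤ (if t < ρ then 1 / 2 else 0) + ε := by
  have h2 : 2 < 1 / ε := by rw [lt_div_iff₀ hε0]; linarith
  have hl : 0 < Real.log (1 / ε - 1) := Real.log_pos (by linarith)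
  have hk0 : 0 < k := lt_of_lt_of_le (div_pos hl hρ) hk
  have hkρ : Real.log (1 / ε - 1) ≤ k * ρ := by
    rwa [ge_iff_le, div_le_iff₀ hρ] at hk
  split_ifs with h
  · have : 1 ≤ Real.exp (k * t) := Real.one_le_exp (by positivity)
    have : 1 / (1 + Real.exp (k * t)) ≤ 1 / 2 :=
      one_div_le_one_div_of_le (by norm_num) (by linarith)
    linarith
  · have h3 : 1 / ε - 1 ≤ Real.exp (k * t) := by
      rw [← Real.log_le_iff_le_exp (by linarith)]
      nlinarith
    rw [zero_add, div_le_iff₀ (by positivity)]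
    have : ε * (1 / ε) = 1 := by field_simp
    nlinarith

lemma aux_flip (x : ℝ) : 1 - 1 / (1 + Real.exp x) = 1 / (1 + Real.exp (-x)) := by
  rw [Real.exp_neg]
  have := Real.exp_pos x
  field_simp
  ring

lemma aux_pt (Δ a b ρ ε k : ℝ) (hρ : 0 < ρ) (hε0 : 0 < ε) (hε1 : ε < 1 / 2)
    (hk : k ≥ Real.log (1 / ε - 1) / ρ) (ha : |a| ≤ Δ) :
    |softRegret k a b - hardRegret a b| ≤ Δ * ((if |b| < ρ then 1 / 2 else 0) + ε) := by
  have key := aux_sig ρ ε k |b| hρ hε0 hε1 hk (abs_nonneg b)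
  have hpos : 0 ≤ 1 / (1 + Real.exp (k * |b|)) := by positivity
  suffices h : |softRegret k a b - hardRegret a b| ≤ |a| * (1 / (1 + Real.exp (k * |b|))) by
    exact h.trans (mul_le_mul ha key hpos ((abs_nonneg a).trans ha))
  have good : ∀ x, x = k * |b| → |(|a| / (1 + Real.exp x) - 0)|
      ≤ |a| * (1 / (1 + Real.exp (k * |b|))) := by
    rintro x rfl
    rw [sub_zero, abs_of_nonneg (by positivity), mul_one_div]
  have bad : ∀ x, x = -(k * |b|) → |(|a| / (1 + Real.exp x) - |a|)|
      ≤ |a| * (1 / (1 + Real.exp (k * |b|))) := by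
    rintro x rfl
    have h := aux_flip (-(k * |b|))
    rw [neg_neg] at h
    have e : |a| / (1 + Real.exp (-(k * |b|))) - |a|
        = -(|a| * (1 / (1 + Real.exp (k * |b|)))) := by rw [← h]; ring
    rw [e, abs_neg, abs_of_nonneg (by positivity)]
  unfold softRegret hardRegret
  rcases lt_trichotomy a 0 with h | rfl | h
  · rw [Real.sign_of_neg h]
    rcases lt_trichotomy b 0 with h' | rfl | h'
    · rw [Real.sign_of_neg h', if_neg (by norm_num)]
      exact good _ (by rw [abs_of_neg h']; ring)
    · rw [Real.sign_zero, if_pos (by norm_num)]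
      exact bad _ (by simp)
    · rw [Real.sign_of_pos h', if_pos (by norm_num)]
      exact bad _ (by rw [abs_of_pos h']; ring)
  · simp
  · rw [Real.sign_of_pos h]
    rcases lt_trichotomy b 0 with h' | rfl | h'
    · rw [Real.sign_of_neg h', if_pos (by norm_num)]
      exact bad _ (by rw [abs_of_neg h']; ring)
    · rw [Real.sign_zero, if_pos (by norm_num)]
      exact bad _ (by simp)
    · rw [Real.sign_of_pos h', if_neg (by norm_num)]
      exact good _ (by rw [abs_of_pos h']; ring)

/-- Bound on the gap between the expected soft regret and the expected regret:
`|∫ SR_k(δ w, g w) dμ − ∫ HR(δ w, g w) dμ| ≤ Δ·(μ{w : |g w| < ρ}/2 + ε)`. -/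
theorem expected_soft_hard_regret_gap
    {𝒲 : Type*} [MeasurableSpace 𝒲] (μ : Measure 𝒲) [IsProbabilityMeasure μ]
    (Δ : ℝ) (hΔ : 0 < Δ) (δ g : 𝒲 → ℝ) (hδ : Measurable δ) (hg : Measurable g)
    (hbound : ∀ w, |δ w| ≤ Δ)
    (ρ ε k : ℝ) (hρ : 0 < ρ) (hε0 : 0 < ε) (hε1 : ε < 1 / 2)
    (hk : k ≥ Real.log (1 / ε - 1) / ρ) :
    |∫ w, softRegret k (δ w) (g w) ∂μ - ∫ w, hardRegret (δ w) (g w) ∂μ| ≤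
      Δ * ((μ {w | |g w| < ρ}).toReal / 2 + ε) := by
  have hsδ : Measurable fun w => Real.sign (δ w) := aux_sign_meas.comp hδ
  have hsg : Measurable fun w => Real.sign (g w) := aux_sign_meas.comp hg
  have hδa : Measurable fun w => |δ w| := by simpa [Real.norm_eq_abs] using hδ.norm
  have hga : Measurable fun w => |g w| := by simpa [Real.norm_eq_abs] using hg.norm
  have hS : Integrable (fun w => softRegret k (δ w) (g w)) μ := by
    refine Integrable.of_bound (C := Δ) (Measurable.aestronglyMeasurable ?_) (.of_forall fun w => ?_)
    · unfold softRegret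
      exact hδa.div (measurable_const.add
        (Real.measurable_exp.comp ((measurable_const.mul hsδ).mul hg)))
    · unfold softRegret
      rw [Real.norm_eq_abs, abs_of_nonneg (by positivity)]
      refine (div_le_self (abs_nonneg _) ?_).trans (hbound w)
      linarith [Real.exp_pos (k * Real.sign (δ w) * g w)]
  have hH : Integrable (fun w => hardRegret (δ w) (g w)) μ := by
    refine Integrable.of_bound (C := Δ) (Measurable.aestronglyMeasurable ?_) (.of_forall fun w => ?_)
    · unfold hardRegret
      exact Measurable.ite (measurableSet_eq_fun hsδ hsg).compl hδa measurable_const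
    · unfold hardRegret
      split_ifs
      · simpa using hbound w
      · simpa using hΔ.le
  have hA : MeasurableSet {w | |g w| < ρ} := measurableSet_lt hga measurable_const
  have hI : Integrable ({w | |g w| < ρ}.indicator fun _ => (1 / 2 : ℝ)) μ :=
    (integrable_const _).indicator hA
  rw [← integral_sub hS hH, ← Real.norm_eq_abs]
  have hB : Integrable (fun w => Δ * ({w | |g w| < ρ}.indicator (fun _ => (1 / 2 : ℝ)) w + ε)) μ :=
    (hI.add (integrable_const ε)).const_mul Δ
  refine (norm_integral_le_of_norm_le hB (.of_forall fun w => ?_)).trans (le_of_eq ?_)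
  · have := aux_pt Δ (δ w) (g w) ρ ε k hρ hε0 hε1 hk (hbound w)
    simpa [Set.indicator_apply] using this
  · rw [integral_const_mul, integral_add hI (integrable_const ε), integral_indicator_const _ hA]
    simp [Measure.real, div_eq_mul_inv]
end

section
/- Let Δ > 0 and k ≥ 0. For all real numbers a, b, b' with |a| ≤ Δ: |SR_k(a, b) − SR_k(a, b')| ≤ Δ·k·|b − b'|/4. -/
open Real

lemma sigmoid_lip_aux (x y : ℝ) : |Real.sigmoid x - Real.sigmoid y| ≤ 1 / 4 * |x - y| := by
  have h := Convex.norm_image_sub_le_of_norm_hasDerivWithin_le (f := Real.sigmoid)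
    (f' := fun x => Real.sigmoid x * (1 - Real.sigmoid x)) (C := 1 / 4) (s := Set.univ)
    (x := y) (y := x)
    (fun z _ => (hasDerivAt_sigmoid z).hasDerivWithinAt)
    (fun z _ => by
      have h0 := Real.sigmoid_pos z
      have h1 := Real.sigmoid_lt_one z
      rw [Real.norm_eq_abs, abs_of_nonneg (mul_nonneg h0.le (by linarith))]
      nlinarith [sq_nonneg (Real.sigmoid z - 1 / 2)])
    convex_univ (Set.mem_univ _) (Set.mem_univ _)
  simpa only [Real.norm_eq_abs] using h

lemma softRegret_eq_aux (k a b : ℝ) :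
    softRegret k a b = |a| * Real.sigmoid (-(k * Real.sign a * b)) := by
  rw [softRegret, Real.sigmoid_def, neg_neg, div_eq_mul_inv]

/-- Lipschitz bound for the soft regret in its second argument:
for `Δ > 0`, `k ≥ 0`, and all reals `a, b, b'` with `|a| ≤ Δ`,
`|SR_k(a, b) − SR_k(a, b')| ≤ Δ·k·|b − b'|/4`. -/
theorem softRegret_lipschitz (Δ k : ℝ) (hΔ : 0 < Δ) (hk : 0 ≤ k) :
    ∀ a b b' : ℝ, |a| ≤ Δ →
      |softRegret k a b - softRegret k a b'| ≤ Δ * k * |b - b'| / 4 := by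
  intro a b b' ha
  have hs : |Real.sign a| ≤ 1 := by
    rcases Real.sign_apply_eq a with h | h | h <;> rw [h] <;> norm_num
  rw [softRegret_eq_aux, softRegret_eq_aux, ← mul_sub, abs_mul, abs_abs]
  have h := sigmoid_lip_aux (-(k * Real.sign a * b)) (-(k * Real.sign a * b'))
  have e : |-(k * Real.sign a * b) - -(k * Real.sign a * b')| = |Real.sign a| * (k * |b - b'|) := by
    rw [show -(k * Real.sign a * b) - -(k * Real.sign a * b') = -(Real.sign a * (k * (b - b'))) by ring,
      abs_neg, abs_mul, abs_mul, abs_of_nonneg hk]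
  rw [e] at h
  have h0 : 0 ≤ k * |b - b'| := by positivity
  have h2 : |Real.sign a| * (k * |b - b'|) ≤ k * |b - b'| := mul_le_of_le_one_left h0 hs
  calc _ ≤ Δ * (1 / 4 * (k * |b - b'|)) :=
        mul_le_mul ha (by linarith) (abs_nonneg _) hΔ.le
    _ = _ := by ring
end
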